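/- arXiv:2002.11428 — 2 statements merged into one kernel-verified Lean document; each statement's English description precedes it below -/
import Mathlib

section
/- Let G' = (V, A', A*) be a shortest path graph with resetting with positive capacities ν and associated matrix M. For the parameters ν₀' = 0 and ℓ₀' = 0, the vector z = 0 is the unique solution of the linear complementarity problem z ≥ 0, M z ≥ 0, zᵀ M z = 0 together with the normalization constraints ℓ'_w ≥ min_{v : (v,w) ∈ A'} ℓ'_v for every w ∈ V∖{s} with no arc of A* entering w. -/
noncomputable section

open Finset

variable {V : Type*}

/-- The function `ϱ^a` prescribing the behavior of labels along an arc. -/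
def arcRho [DecidableEq V] (Astar : Finset (V × V)) (nu : V × V → ℝ)
    (a : V × V) (lv xa : ℝ) : ℝ :=
  if a ∈ Astar then xa / nu a else max lv (xa / nu a)

/-- Total flow on arcs of `Aset` leaving `v`. -/
def outSum [DecidableEq V] (Aset : Finset (V × V)) (x : V × V → ℝ) (v : V) : ℝ :=
  ∑ a ∈ Aset.filter (fun a => a.1 = v), x a

/-- Total flow on arcs of `Aset` entering `v`. -/
def inSum [DecidableEq V] (Aset : Finset (V × V)) (x : V × V → ℝ) (v : V) : ℝ :=
  ∑ a ∈ Aset.filter (fun a => a.2 = v), x a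

/-- `(V, Aset, Astar)` is a shortest path graph with resetting with source `s`:
`Astar ⊆ Aset`, `(V, Aset)` is acyclic, and every vertex is reachable from `s`. -/
def IsSPGR [DecidableEq V] (Aset Astar : Finset (V × V)) (s : V) : Prop :=
  Astar ⊆ Aset ∧
  (∀ v : V, ¬ Relation.TransGen (fun u w => (u, w) ∈ Aset) v v) ∧
  (∀ v : V, Relation.ReflTransGen (fun u w => (u, w) ∈ Aset) s v)

/-- `x` is a static `s`-`t` flow of value `val` on the arcs `Aset`,
with conservation required at the vertices of `Vset`. -/
def IsFlowOn [DecidableEq V] (Vset : Finset V) (Aset : Finset (V × V)) (s t : V)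
    (x : V × V → ℝ) (val : ℝ) : Prop :=
  (∀ a ∈ Aset, 0 ≤ x a) ∧
  (∀ v ∈ Vset, v ≠ s → v ≠ t → outSum Aset x v = inSum Aset x v) ∧
  outSum Aset x s - inSum Aset x s = val

/-- `x` is a normalized thin `s`-`t` flow with resetting of value `val`
with corresponding labels `l`. -/
def IsNTFOn [DecidableEq V] (Vset : Finset V) (Aset Astar : Finset (V × V)) (nu : V × V → ℝ)
    (s t : V) (x : V × V → ℝ) (val : ℝ) (l : V → ℝ) : Prop :=
  IsFlowOn Vset Aset s t x val ∧
  (∀ v ∈ Vset, 0 ≤ l v) ∧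
  (∀ w ∈ Vset, w ≠ s →
    (∀ a ∈ Aset, a.2 = w → l w ≤ arcRho Astar nu a (l a.1) (x a)) ∧
    (∃ a ∈ Aset, a.2 = w ∧ l w = arcRho Astar nu a (l a.1) (x a))) ∧
  (∀ a ∈ Aset, 0 < x a → l a.2 = arcRho Astar nu a (l a.1) (x a))

/-- Normalized thin `s`-`t` flow with resetting on the whole vertex type. -/
def IsNTF [DecidableEq V] [Fintype V] (Aset Astar : Finset (V × V)) (nu : V × V → ℝ)
    (s t : V) (x : V × V → ℝ) (val : ℝ) (l : V → ℝ) : Prop :=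
  IsNTFOn Finset.univ Aset Astar nu s t x val l

/-- Index set `V ⊔ A' ⊔ (A' \ A*)` of the linear complementarity problem. -/
abbrev LCPIdx [DecidableEq V] (Aset Astar : Finset (V × V)) :=
  V ⊕ ({a : V × V // a ∈ Aset} ⊕ {a : V × V // a ∈ Aset \ Astar})

/-- The matrix `M` of the linear complementarity problem. -/
def lcpM [DecidableEq V] (Aset Astar : Finset (V × V)) (nu : V × V → ℝ) (s : V) :
    Matrix (LCPIdx Aset Astar) (LCPIdx Aset Astar) ℝ :=
  fun i j =>
    match i, j with
    | Sum.inl v, Sum.inl u => if v = s ∧ u = s then 1 else 0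
    | Sum.inl v, Sum.inr (Sum.inl b) =>
        if v = s then 0
        else (if b.val.2 = v then (1 : ℝ) else 0) - (if b.val.1 = v then (1 : ℝ) else 0)
    | Sum.inl _, Sum.inr (Sum.inr _) => 0
    | Sum.inr (Sum.inl a), Sum.inl u => -(if a.val.2 = u then (1 : ℝ) else 0)
    | Sum.inr (Sum.inl a), Sum.inr (Sum.inl b) => if a.val = b.val then (nu a.val)⁻¹ else 0
    | Sum.inr (Sum.inl a), Sum.inr (Sum.inr b) => if a.val = b.val then 1 else 0
    | Sum.inr (Sum.inr a), Sum.inl u => -(if a.val.1 = u then (1 : ℝ) else 0)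
    | Sum.inr (Sum.inr a), Sum.inr (Sum.inl b) => if a.val = b.val then (nu a.val)⁻¹ else 0
    | Sum.inr (Sum.inr a), Sum.inr (Sum.inr b) => if a = b then 1 else 0

/-- The vector `z = (ℓ', x', y')`. -/
def lcpZ [DecidableEq V] (Aset Astar : Finset (V × V))
    (l : V → ℝ) (x y : V × V → ℝ) : LCPIdx Aset Astar → ℝ :=
  Sum.elim l (Sum.elim (fun a => x a.val) (fun a => y a.val))

/-- The right hand side `ℓ₀'·1_s + ν₀'·1_t`. -/
def lcpQ [DecidableEq V] (Aset Astar : Finset (V × V)) (s t : V) (l0 nu0 : ℝ) :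
    LCPIdx Aset Astar → ℝ :=
  fun i => (if i = Sum.inl s then l0 else 0) + (if i = Sum.inl t then nu0 else 0)

/-- `z` solves the LCP: `z ≥ 0`, `M z − ℓ₀'·1_s − ν₀'·1_t ≥ 0`,
`zᵀ (M z − ℓ₀'·1_s − ν₀'·1_t) = 0`. -/
def IsLCPSol [DecidableEq V] [Fintype V] (Aset Astar : Finset (V × V)) (nu : V × V → ℝ)
    (s t : V) (l0 nu0 : ℝ) (z : LCPIdx Aset Astar → ℝ) : Prop :=
  (∀ i, 0 ≤ z i) ∧
  (∀ i, 0 ≤ (lcpM Aset Astar nu s).mulVec z i - lcpQ Aset Astar s t l0 nu0 i) ∧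
  ∑ i, z i * ((lcpM Aset Astar nu s).mulVec z i - lcpQ Aset Astar s t l0 nu0 i) = 0

/-- The normalization constraints: `ℓ'_w ≥ min_{v : (v,w) ∈ A'} ℓ'_v` for every
`w ≠ s` not entered by any resetting arc. -/
def NormConstraint [DecidableEq V] (Aset Astar : Finset (V × V)) (s : V) (l : V → ℝ) : Prop :=
  ∀ w : V, w ≠ s → (∀ a ∈ Astar, a.2 ≠ w) → ∃ a ∈ Aset, a.2 = w ∧ l a.1 ≤ l w

section MulVec

variable [DecidableEq V] [Fintype V] {Aset Astar : Finset (V × V)} {nu : V × V → ℝ} {s : V}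
  (z : LCPIdx Aset Astar → ℝ)

lemma lcpM_mulVec_source : (lcpM Aset Astar nu s).mulVec z (Sum.inl s) = z (Sum.inl s) := by
  simp [Matrix.mulVec, dotProduct, lcpM]

lemma lcpM_mulVec_vertex {v : V} (hv : v ≠ s) :
    (lcpM Aset Astar nu s).mulVec z (Sum.inl v) =
      (∑ b : {a : V × V // a ∈ Aset}, if b.val.2 = v then z (Sum.inr (Sum.inl b)) else 0) -
      ∑ b : {a : V × V // a ∈ Aset}, if b.val.1 = v then z (Sum.inr (Sum.inl b)) else 0 := by
  simp [Matrix.mulVec, dotProduct, lcpM, hv, sub_mul, Finset.sum_sub_distrib]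

lemma lcpM_mulVec_arc (a : {a : V × V // a ∈ Aset}) :
    (lcpM Aset Astar nu s).mulVec z (Sum.inr (Sum.inl a)) =
      -z (Sum.inl a.val.2) + (nu a.val)⁻¹ * z (Sum.inr (Sum.inl a)) +
      ∑ b : {a : V × V // a ∈ Aset \ Astar},
        if a.val = b.val then z (Sum.inr (Sum.inr b)) else 0 := by
  simp [Matrix.mulVec, dotProduct, lcpM, add_assoc]

lemma lcpM_mulVec_nonresetting (a : {a : V × V // a ∈ Aset \ Astar}) :
    (lcpM Aset Astar nu s).mulVec z (Sum.inr (Sum.inr a)) =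
      -z (Sum.inl a.val.1) +
      (nu a.val)⁻¹ * z (Sum.inr (Sum.inl ⟨a.val, (Finset.mem_sdiff.mp a.prop).1⟩)) +
      z (Sum.inr (Sum.inr a)) := by
  have h (b : {a : V × V // a ∈ Aset}) :
      a.val = b.val ↔ (⟨a.val, (Finset.mem_sdiff.mp a.prop).1⟩ : {a // a ∈ Aset}) = b := by
    rw [Subtype.ext_iff]
  simp [Matrix.mulVec, dotProduct, lcpM, h, add_assoc]

end MulVec

section Solution

variable [DecidableEq V] [Fintype V] {Aset Astar : Finset (V × V)} {nu : V × V → ℝ} {s t : V}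
  {z : LCPIdx Aset Astar → ℝ}

lemma isLCPSol_zero_iff :
    IsLCPSol Aset Astar nu s t 0 0 z ↔
      (∀ i, 0 ≤ z i) ∧ (∀ i, 0 ≤ (lcpM Aset Astar nu s).mulVec z i) ∧
      ∀ i, z i = 0 ∨ (lcpM Aset Astar nu s).mulVec z i = 0 := by
  simp only [IsLCPSol, lcpQ, ite_self, add_zero, sub_zero]
  refine and_congr_right fun hz => and_congr_right fun hM => ?_
  rw [Finset.sum_eq_zero_iff_of_nonneg fun i _ => mul_nonneg (hz i) (hM i)]
  simp only [Finset.mem_univ, true_imp_iff, mul_eq_zero]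

lemma IsLCPSol.source_eq_zero (h : IsLCPSol Aset Astar nu s t 0 0 z) : z (Sum.inl s) = 0 := by
  have := (isLCPSol_zero_iff.mp h).2.2 (Sum.inl s)
  rwa [lcpM_mulVec_source, or_self] at this

/-- Positive flow into a vertex is conserved there, so acyclicity rules it out. -/
lemma IsLCPSol.flow_eq_zero (hG : IsSPGR Aset Astar s) (hnu : ∀ a ∈ Aset, 0 < nu a)
    (h : IsLCPSol Aset Astar nu s t 0 0 z) (a : {a : V × V // a ∈ Aset}) :
    z (Sum.inr (Sum.inl a)) = 0 := by
  obtain ⟨hz, -, hc⟩ := isLCPSol_zero_iff.mp h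
  let r : V → V → Prop := fun w v => Relation.TransGen (fun u w => (u, w) ∈ Aset) v w
  have : IsTrans V r := ⟨fun _ _ _ h₁ h₂ => h₂.trans h₁⟩
  have : Std.Irrefl r := ⟨hG.2.1⟩
  have key : ∀ v : V, ∀ a : {a : V × V // a ∈ Aset}, a.val.2 = v →
      z (Sum.inr (Sum.inl a)) = 0 := by
    intro v
    induction v using (Finite.wellFounded_of_trans_of_irrefl r).induction with
    | _ v ih =>
    intro a hav
    rcases hc (Sum.inr (Sum.inl a)) with h0 | h0
    · exact h0
    by_contra hne
    have hx : 0 < z (Sum.inr (Sum.inl a)) := lt_of_le_of_ne (hz _) (Ne.symm hne)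
    rw [lcpM_mulVec_arc, hav] at h0
    have hsum : 0 ≤ ∑ b : {a : V × V // a ∈ Aset \ Astar},
        if a.val = b.val then z (Sum.inr (Sum.inr b)) else 0 :=
      Finset.sum_nonneg fun b _ => by split_ifs <;> simp [hz]
    have hpos := mul_pos (inv_pos.mpr (hnu a.val a.prop)) hx
    have hl : 0 < z (Sum.inl v) := by linarith
    have hvs : v ≠ s := by
      rintro rfl
      exact hl.ne' h.source_eq_zero
    have hcons := (hc (Sum.inl v)).resolve_left hl.ne'
    rw [lcpM_mulVec_vertex z hvs] at hcons
    have hout : (∑ b : {a : V × V // a ∈ Aset},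
        if b.val.1 = v then z (Sum.inr (Sum.inl b)) else 0) = 0 := by
      refine Finset.sum_eq_zero fun b _ => ?_
      split_ifs with hb
      · refine ih b.val.2 (Relation.TransGen.single ?_) b rfl
        rw [← hb]
        exact b.prop
      · rfl
    have hin : z (Sum.inr (Sum.inl a)) ≤ ∑ b : {a : V × V // a ∈ Aset},
        if b.val.2 = v then z (Sum.inr (Sum.inl b)) else 0 := by
      have := Finset.single_le_sum
        (f := fun b : {a : V × V // a ∈ Aset} =>
          if b.val.2 = v then z (Sum.inr (Sum.inl b)) else 0)
        (fun b _ => by split_ifs <;> simp [hz]) (Finset.mem_univ a)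
      simpa only [hav, if_true] using this
    linarith
  exact key _ a rfl

lemma IsLCPSol.slack_eq (hG : IsSPGR Aset Astar s) (hnu : ∀ a ∈ Aset, 0 < nu a)
    (h : IsLCPSol Aset Astar nu s t 0 0 z) (a : {a : V × V // a ∈ Aset \ Astar}) :
    z (Sum.inr (Sum.inr a)) = z (Sum.inl a.val.1) := by
  obtain ⟨hz, hM, hc⟩ := isLCPSol_zero_iff.mp h
  have h1 := hM (Sum.inr (Sum.inr a))
  have h2 := hc (Sum.inr (Sum.inr a))
  rw [lcpM_mulVec_nonresetting, h.flow_eq_zero hG hnu] at h1 h2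
  have h3 := hz (Sum.inl a.val.1)
  rcases h2 with h2 | h2 <;> linarith

lemma IsLCPSol.label_le (hG : IsSPGR Aset Astar s) (hnu : ∀ a ∈ Aset, 0 < nu a)
    (h : IsLCPSol Aset Astar nu s t 0 0 z) {u w : V} (huw : (u, w) ∈ Aset) :
    z (Sum.inl w) ≤ z (Sum.inl u) := by
  obtain ⟨hz, hM, -⟩ := isLCPSol_zero_iff.mp h
  have h1 := hM (Sum.inr (Sum.inl ⟨(u, w), huw⟩))
  rw [lcpM_mulVec_arc, h.flow_eq_zero hG hnu] at h1
  have h2 : (∑ b : {a : V × V // a ∈ Aset \ Astar},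
      if (u, w) = b.val then z (Sum.inr (Sum.inr b)) else 0) ≤ z (Sum.inl u) := by
    by_cases hs : (u, w) ∈ Astar
    · rw [Finset.sum_eq_zero]
      · exact hz _
      · intro b _
        rw [if_neg]
        intro hb
        exact (Finset.mem_sdiff.mp b.prop).2 (hb ▸ hs)
    · let a : {a : V × V // a ∈ Aset \ Astar} := ⟨(u, w), Finset.mem_sdiff.mpr ⟨huw, hs⟩⟩
      have ha (b : {a : V × V // a ∈ Aset \ Astar}) : (u, w) = b.val ↔ a = b := by
        rw [Subtype.ext_iff]
      simp only [ha, Finset.sum_ite_eq, Finset.mem_univ, if_true]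
      exact (h.slack_eq hG hnu a).le
  linarith

lemma IsLCPSol.eq_zero (hG : IsSPGR Aset Astar s) (hnu : ∀ a ∈ Aset, 0 < nu a)
    (h : IsLCPSol Aset Astar nu s t 0 0 z) : z = 0 := by
  have hl : ∀ v, z (Sum.inl v) = 0 := by
    intro v
    refine le_antisymm ?_ (h.1 _)
    induction hG.2.2 v with
    | refl => exact h.source_eq_zero.le
    | tail _ huw ih => exact (h.label_le hG hnu huw).trans ih
  funext i
  rcases i with v | a | a
  · exact hl v
  · exact h.flow_eq_zero hG hnu a
  · exact (h.slack_eq hG hnu a).trans (hl _)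

end Solution

lemma IsSPGR.normConstraint_zero [DecidableEq V] {Aset Astar : Finset (V × V)} {s : V}
    (hG : IsSPGR Aset Astar s) : NormConstraint Aset Astar s 0 := by
  intro w hw _
  rcases (hG.2.2 w).cases_tail with h | ⟨u, -, huw⟩
  · exact absurd h hw
  · exact ⟨(u, w), huw, rfl, le_rfl⟩

/-- For `ν₀' = 0` and `ℓ₀' = 0`, the zero vector is the unique
solution of the LCP together with the normalization constraints. -/
theorem statement8 [DecidableEq V] [Fintype V]
    (Aset Astar : Finset (V × V)) (s t : V) (nu : V × V → ℝ)
    (hG : IsSPGR Aset Astar s) (hnu : ∀ a ∈ Aset, 0 < nu a) :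
    ∀ z : LCPIdx Aset Astar → ℝ,
      (IsLCPSol Aset Astar nu s t 0 0 z ∧
        NormConstraint Aset Astar s (fun v => z (Sum.inl v))) ↔ z = 0 := by
  refine fun z => ⟨fun h => h.1.eq_zero hG hnu, ?_⟩
  rintro rfl
  exact ⟨isLCPSol_zero_iff.mpr (by simp), hG.normConstraint_zero⟩
end
end

section
/- Let G' = (V, A', A*) be a shortest path graph with resetting with positive capacities ν, and let ϱ^{G'} : ℝ_{≥0} → ℝ_{≥0}^V be the (unique) label function, i.e., for each ν₀' ≥ 0, ϱ^{G'}(ν₀') are the corresponding labels of some normalized thin s–t flow with resetting of value ν₀' in G' with ϱ^{G'}_s(ν₀') = 1. Then for every v ∈ V: the function ν₀' ↦ ϱ^{G'}_v(ν₀') is monotonically non-decreasing on ℝ_{≥0}, and the function ν₀' ↦ ϱ^{G'}_v(ν₀')/ν₀' is monotonically non-increasing on ℝ_{>0}. -/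
noncomputable section

open Finset

variable {V : Type*}

theorem arcRho_mul [DecidableEq V] (Astar : Finset (V × V)) (nu : V × V → ℝ) (a : V × V)
    {c : ℝ} (hc : 0 ≤ c) (l x : ℝ) :
    arcRho Astar nu a (c * l) (c * x) = c * arcRho Astar nu a l x := by
  unfold arcRho
  split_ifs
  · rw [mul_div_assoc]
  · rw [mul_div_assoc, mul_max_of_nonneg _ _ hc]

theorem arcRho_mono [DecidableEq V] (Astar : Finset (V × V)) {nu : V × V → ℝ} {a : V × V}
    (ha : 0 < nu a) {l m x y : ℝ} (hl : l ≤ m) (hx : x ≤ y) :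
    arcRho Astar nu a l x ≤ arcRho Astar nu a m y := by
  unfold arcRho
  have h : x / nu a ≤ y / nu a := div_le_div_of_nonneg_right hx ha.le
  split_ifs
  · exact h
  · exact max_le_max hl h

/-- A strictly smaller label at the tail forces at least as much flow on the arc
to reach the same value. -/
theorem le_of_arcRho_le [DecidableEq V] {Astar : Finset (V × V)} {nu : V × V → ℝ} {a : V × V}
    (ha : 0 < nu a) {l m x y : ℝ} (hl : m < l)
    (h : arcRho Astar nu a l x ≤ arcRho Astar nu a m y) : x ≤ y := by
  rw [← div_le_div_iff_of_pos_right ha]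
  unfold arcRho at h
  split_ifs at h
  · exact h
  · rcases le_max_iff.mp ((le_max_left _ _).trans h) with h' | h'
    · exact absurd h' hl.not_ge
    · rw [max_eq_right (hl.le.trans h')] at h
      exact (le_max_right _ _).trans h

/-- The total excess of a vertex set is the inflow minus the outflow over its boundary. -/
theorem sum_inSum_sub_outSum [DecidableEq V] (Aset : Finset (V × V)) (x : V × V → ℝ)
    (S : Finset V) :
    ∑ v ∈ S, (inSum Aset x v - outSum Aset x v) =
      ∑ a ∈ Aset, ((if a.2 ∈ S then x a else 0) - (if a.1 ∈ S then x a else 0)) := by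
  simp only [inSum, outSum, Finset.sum_filter, Finset.sum_sub_distrib]
  congr 1
  all_goals
    rw [Finset.sum_comm]
    exact Finset.sum_congr rfl fun a _ => by simp

theorem IsFlowOn.sum_excess [DecidableEq V] [Fintype V] {Aset : Finset (V × V)} {s t : V}
    {x : V × V → ℝ} {q : ℝ} (h : IsFlowOn Finset.univ Aset s t x q) {S : Finset V}
    (hs : s ∉ S) :
    ∑ v ∈ S, (inSum Aset x v - outSum Aset x v) = if t ∈ S then q else 0 := by
  obtain ⟨-, hcons, hval⟩ := h
  have hzero : ∀ v, v ≠ s → v ≠ t → inSum Aset x v - outSum Aset x v = 0 := fun v h1 h2 => by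
    rw [hcons v (Finset.mem_univ v) h1 h2, sub_self]
  split_ifs with ht
  · have htotal : ∑ v, (inSum Aset x v - outSum Aset x v) = 0 := by
      rw [sum_inSum_sub_outSum]; simp
    rw [← Finset.sum_add_sum_compl S, Finset.sum_eq_single_of_mem (s := Sᶜ) s (by simpa using hs)
      fun v hv hvs => hzero v hvs (by rintro rfl; exact Finset.mem_compl.mp hv ht)] at htotal
    linarith
  · exact Finset.sum_eq_zero fun v hv =>
      hzero v (by rintro rfl; exact hs hv) (by rintro rfl; exact ht hv)

theorem IsSPGR.head_ne_source [DecidableEq V] {Aset Astar : Finset (V × V)} {s : V}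
    (hG : IsSPGR Aset Astar s) {a : V × V} (ha : a ∈ Aset) : a.2 ≠ s := by
  rintro rfl
  exact hG.2.1 a.2 (Relation.TransGen.tail' (hG.2.2 a.1) ha)

/-- Every nonempty set of vertices has a member all of whose predecessors lie outside the set. -/
theorem IsSPGR.exists_minimal [DecidableEq V] [Fintype V] {Aset Astar : Finset (V × V)} {s : V}
    (hG : IsSPGR Aset Astar s) {S : Finset V} (hS : S.Nonempty) :
    ∃ w ∈ S, ∀ a ∈ Aset, a.2 = w → a.1 ∉ S := by
  let r : V → V → Prop := Relation.TransGen fun u w => (u, w) ∈ Aset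
  have : IsTrans V r := ⟨fun _ _ _ => Relation.TransGen.trans⟩
  have : Std.Irrefl r := ⟨hG.2.1⟩
  obtain ⟨w, hw, hmin⟩ := (Finite.wellFounded_of_trans_of_irrefl r).has_min (S : Set V) hS
  refine ⟨w, hw, ?_⟩
  rintro a ha rfl h
  exact hmin a.1 h (Relation.TransGen.single ha)

theorem IsNTF.smul [DecidableEq V] [Fintype V] {Aset Astar : Finset (V × V)}
    {nu : V × V → ℝ} {s t : V} {x : V × V → ℝ} {q : ℝ} {l : V → ℝ}
    (h : IsNTF Aset Astar nu s t x q l) {c : ℝ} (hc : 0 < c) :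
    IsNTF Aset Astar nu s t (fun a => c * x a) (c * q) (fun v => c * l v) := by
  obtain ⟨⟨h0, hcons, hval⟩, hl, hmin, hact⟩ := h
  have hout : ∀ v, outSum Aset (fun a => c * x a) v = c * outSum Aset x v := fun v => by
    simp only [outSum, Finset.mul_sum]
  have hin : ∀ v, inSum Aset (fun a => c * x a) v = c * inSum Aset x v := fun v => by
    simp only [inSum, Finset.mul_sum]
  refine ⟨⟨fun a ha => mul_nonneg hc.le (h0 a ha), fun v hv h1 h2 => ?_, ?_⟩,
    fun v hv => mul_nonneg hc.le (hl v hv), fun w hw hws => ⟨fun a ha haw => ?_, ?_⟩,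
    fun a ha hxa => ?_⟩
  · rw [hout, hin, hcons v hv h1 h2]
  · rw [hout, hin, ← mul_sub, hval]
  · rw [arcRho_mul _ _ _ hc.le]
    exact mul_le_mul_of_nonneg_left ((hmin w hw hws).1 a ha haw) hc.le
  · obtain ⟨a, ha, haw, heq⟩ := (hmin w hw hws).2
    exact ⟨a, ha, haw, by simp only [arcRho_mul _ _ _ hc.le, heq]⟩
  · simp only [arcRho_mul _ _ _ hc.le, hact a ha (pos_of_mul_pos_right hxa hc.le)]

/-- Comparison principle: a thin flow with larger value and larger source label has
larger labels everywhere. -/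
theorem IsNTF.label_le [DecidableEq V] [Fintype V] {Aset Astar : Finset (V × V)}
    {nu : V × V → ℝ} {s t : V} (hG : IsSPGR Aset Astar s) (hnu : ∀ a ∈ Aset, 0 < nu a)
    {x y : V × V → ℝ} {p q : ℝ} {l m : V → ℝ}
    (hx : IsNTF Aset Astar nu s t x p l) (hy : IsNTF Aset Astar nu s t y q m)
    (hpq : p ≤ q) (hs : l s ≤ m s) (v : V) : l v ≤ m v := by
  by_contra! hv
  let S : Finset V := Finset.univ.filter fun v => m v < l v
  have memS : ∀ v, v ∈ S ↔ m v < l v := fun v => by simp [S]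
  have hsS : s ∉ S := by simpa [memS] using hs
  obtain ⟨hxf, -, hxmin, hxact⟩ := hx
  obtain ⟨hyf, -, hymin, hyact⟩ := hy
  have hxle : ∀ a ∈ Aset, l a.2 ≤ arcRho Astar nu a (l a.1) (x a) := fun a ha =>
    (hxmin a.2 (Finset.mem_univ _) (hG.head_ne_source ha)).1 a ha rfl
  have hyle : ∀ a ∈ Aset, m a.2 ≤ arcRho Astar nu a (m a.1) (y a) := fun a ha =>
    (hymin a.2 (Finset.mem_univ _) (hG.head_ne_source ha)).1 a ha rfl
  have enter : ∀ a ∈ Aset, a.2 ∈ S → a.1 ∉ S → y a ≤ x a := by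
    intro a ha h2 h1
    rw [memS] at h2 h1
    by_contra! hlt
    have := arcRho_mono Astar (hnu a ha) (not_lt.mp h1) hlt.le
    linarith [hxle a ha, hyact a ha ((hxf.1 a ha).trans_lt hlt)]
  have leave : ∀ a ∈ Aset, a.2 ∉ S → a.1 ∈ S → x a ≤ y a := by
    intro a ha h2 h1
    rw [memS] at h2 h1
    rcases (hxf.1 a ha).eq_or_lt with h | h
    · exact h ▸ hyf.1 a ha
    · exact le_of_arcRho_le (hnu a ha) h1
        (by linarith [hyle a ha, hxact a ha h] : arcRho Astar nu a (l a.1) (x a) ≤ _)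
  let d : (V × V → ℝ) → V × V → ℝ := fun z a =>
    (if a.2 ∈ S then z a else 0) - (if a.1 ∈ S then z a else 0)
  have hd : ∀ a ∈ Aset, d y a ≤ d x a := by
    intro a ha
    by_cases h2 : a.2 ∈ S <;> by_cases h1 : a.1 ∈ S
    · simp [d, h2, h1]
    · simpa [d, h2, h1] using enter a ha h2 h1
    · simpa [d, h2, h1] using leave a ha h2 h1
    · simp [d, h2, h1]
  have hsum : ∑ a ∈ Aset, d x a ≤ ∑ a ∈ Aset, d y a := by
    rw [← sum_inSum_sub_outSum, ← sum_inSum_sub_outSum, hxf.sum_excess hsS, hyf.sum_excess hsS]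
    split_ifs
    exacts [hpq, le_rfl]
  have heq := (Finset.sum_eq_sum_iff_of_le hd).mp ((Finset.sum_le_sum hd).antisymm hsum)
  obtain ⟨w, hw, hwmin⟩ := hG.exists_minimal ⟨v, (memS v).mpr hv⟩
  obtain ⟨a, ha, rfl, hmw⟩ :=
    (hymin w (Finset.mem_univ w) (by rintro rfl; exact hsS hw)).2
  have h1 := hwmin a ha rfl
  have hxy : y a = x a := by simpa [d, hw, h1] using heq a ha
  have := arcRho_mono Astar (hnu a ha) (not_lt.mp fun h => h1 ((memS _).mpr h)) hxy.ge
  linarith [hxle a ha, (memS _).mp hw]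

/-- Monotonicity of the parametric labels: `ϱ_v` is
non-decreasing and `ϱ_v(ν₀')/ν₀'` is non-increasing. -/
theorem statement13 [DecidableEq V] [Fintype V]
    (Aset Astar : Finset (V × V)) (s t : V) (nu : V × V → ℝ)
    (hG : IsSPGR Aset Astar s) (hnu : ∀ a ∈ Aset, 0 < nu a)
    (rho : ℝ → V → ℝ)
    (hrho : ∀ q : ℝ, 0 ≤ q → ∃ x : V × V → ℝ,
      IsNTF Aset Astar nu s t x q (rho q) ∧ rho q s = 1) :
    ∀ v : V,
      MonotoneOn (fun q => rho q v) (Set.Ici 0) ∧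
      AntitoneOn (fun q => rho q v / q) (Set.Ioi 0) := by
  intro v
  refine ⟨fun p hp q hq hpq => ?_, fun p hp q hq hpq => ?_⟩
  · obtain ⟨x, hx, hxs⟩ := hrho p hp
    obtain ⟨y, hy, hys⟩ := hrho q hq
    exact hx.label_le hG hnu hy hpq (by rw [hxs, hys]) v
  · have hp' : 0 < p := hp
    have hq' : 0 < q := hq
    obtain ⟨x, hx, hxs⟩ := hrho p hp'.le
    obtain ⟨y, hy, hys⟩ := hrho q hq'.le
    have h := hy.label_le hG hnu (hx.smul (div_pos hq' hp')) (div_mul_cancel₀ q hp'.ne').ge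
      (by rw [hxs, hys, mul_one]; exact (one_le_div hp').mpr hpq) v
    change rho q v / q ≤ rho p v / p
    rw [div_le_iff₀ hq']
    calc rho q v ≤ q / p * rho p v := h
      _ = rho p v / p * q := by ring
end
end
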